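/- Let R be a Γ-graded von Neumann regular graded right self-injective ring and J a graded two-sided ideal of R. Then there exists a unique central homogeneous idempotent e of R (of degree 0) such that J ⊆ eR and J is graded essential in eR as graded right ideals. -/

import Mathlib

/- Setting: `Γ = ι` an additive abelian group, `R` a `ι`-graded ring with identity,
with homogeneous components the additive subgroups `𝒜 γ`. -/

variable {ι R : Type*}

section Defs
variable [DecidableEq ι] [AddCommGroup ι] [Ring R] (𝒜 : ι → AddSubgroup R) [GradedRing 𝒜]

/-- An element of `R` is homogeneous if it lies in some component `𝒜 γ`. -/
def IsHomog (a : R) : Prop := ∃ γ : ι, a ∈ 𝒜 γ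

/-- `R` is graded von Neumann regular: every homogeneous element has an inner inverse. -/
def GradedVNRegular : Prop := ∀ a : R, IsHomog 𝒜 a → ∃ b : R, a * b * a = a

/-- A subset of `R` is a right ideal. -/
def IsRightIdealSet (I : Set R) : Prop :=
  (0 : R) ∈ I ∧ (∀ x ∈ I, ∀ y ∈ I, x + y ∈ I) ∧ ∀ x ∈ I, ∀ r : R, x * r ∈ I

/-- A graded right ideal: a right ideal containing all homogeneous components of
its elements. -/
def IsGradedRightIdeal (I : Set R) : Prop :=
  IsRightIdealSet I ∧ ∀ x ∈ I, ∀ γ : ι, ((DirectSum.decompose 𝒜 x γ : 𝒜 γ) : R) ∈ I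

/-- `A` is graded essential in `B` (as graded right ideals): `A ⊆ B` and every nonzero
graded right ideal contained in `B` meets `A` nontrivially. -/
def GradedEssentialIn (A B : Set R) : Prop :=
  A ⊆ B ∧ ∀ J : Set R, IsGradedRightIdeal 𝒜 J → J ⊆ B → (∃ x ∈ J, x ≠ 0) →
    ∃ x, x ∈ A ∩ J ∧ x ≠ 0

/-- Graded Baer criterion: `R` is graded right self-injective. A homomorphism from a
graded right ideal `I` to `R` is encoded as a function `f : R → R` which is additive on
`I`, right `R`-linear on `I`, and of degree `γ` on `I`. -/
def GradedSelfInjective : Prop :=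
  ∀ I : Set R, IsGradedRightIdeal 𝒜 I → ∀ γ : ι, ∀ f : R → R,
    (∀ x ∈ I, ∀ y ∈ I, f (x + y) = f x + f y) →
    (∀ x ∈ I, ∀ r : R, f (x * r) = f x * r) →
    (∀ δ : ι, ∀ x ∈ I, x ∈ 𝒜 δ → f x ∈ 𝒜 (γ + δ)) →
    ∃ c ∈ 𝒜 γ, ∀ x ∈ I, f x = c * x

/-- A graded two-sided ideal of `R`. -/
def IsGradedTwoSidedIdeal (J : Set R) : Prop :=
  IsGradedRightIdeal 𝒜 J ∧ ∀ x ∈ J, ∀ r : R, r * x ∈ J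

end Defs

/-- Let `R` be a graded von Neumann regular graded right self-injective
ring and `J` a graded two-sided ideal. Then there is a unique central homogeneous
idempotent `e` (of degree `0`) such that `J ⊆ eR` and `J` is graded essential in `eR`
(with `eR` encoded as `{x | e * x = x}`). -/
theorem unique_central_idempotent_essential_over_ideal
    [DecidableEq ι] [AddCommGroup ι] [Ring R] (𝒜 : ι → AddSubgroup R) [GradedRing 𝒜]
    (hreg : GradedVNRegular 𝒜) (hinj : GradedSelfInjective 𝒜)
    (J : Set R) (hJ : IsGradedTwoSidedIdeal 𝒜 J) :
    ∃! e : R, e ∈ 𝒜 (0 : ι) ∧ e * e = e ∧ (∀ r : R, e * r = r * e) ∧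
      GradedEssentialIn 𝒜 J {x : R | e * x = x} := by
  classical
  obtain ⟨⟨⟨J0, Jadd, Jmul⟩, Jgr⟩, Jl⟩ := hJ
  have Jneg : ∀ x ∈ J, -x ∈ J := fun x hx => by
    have := Jmul x hx (-1)
    simpa using this
  -- zero test through components
  have zt : ∀ x : R, (∀ γ, ((DirectSum.decompose 𝒜 x γ : 𝒜 γ) : R) = 0) → x = 0 := by
    intro x hx
    rw [← DirectSum.sum_support_decompose 𝒜 x]
    exact Finset.sum_eq_zero fun i _ => hx i
  have kz : ∀ x : R, (∀ γ, ∀ j ∈ J, j ∈ 𝒜 γ → j * x = 0) → ∀ j ∈ J, j * x = 0 := by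
    intro x hx j hj
    rw [← DirectSum.sum_support_decompose 𝒜 j, Finset.sum_mul]
    exact Finset.sum_eq_zero fun i _ => hx i _ (Jgr j hj i) (SetLike.coe_mem _)
  have Ngr : ∀ x : R, (∀ j ∈ J, j * x = 0) → ∀ γ, ∀ j ∈ J,
      j * ((DirectSum.decompose 𝒜 x γ : 𝒜 γ) : R) = 0 := by
    intro x hx γ
    apply kz
    intro δ j hj hd
    rw [← DirectSum.coe_decompose_mul_add_of_left_mem 𝒜 hd, hx j hj]
    simp
  have JN : ∀ x ∈ J, (∀ j ∈ J, j * x = 0) → x = 0 := by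
    intro x hx hN
    apply zt
    intro γ
    obtain ⟨b, hb⟩ := hreg _ ⟨γ, SetLike.coe_mem (DirectSum.decompose 𝒜 x γ)⟩
    rw [← hb]
    exact Ngr x hN γ _ (Jmul _ (Jgr x hx γ) b)
  -- left annihilator inside right annihilator, homogeneous elements
  have lr : ∀ γ, ∀ x ∈ 𝒜 γ, (∀ j ∈ J, x * j = 0) → ∀ j ∈ J, j * x = 0 := by
    intro γ x hx h
    apply kz
    intro δ j hj hd
    obtain ⟨b, hb⟩ := hreg (j * x) ⟨δ + γ, SetLike.mul_mem_graded hd hx⟩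
    rw [← hb]
    have := h (b * j) (Jl j hj b)
    calc j * x * b * (j * x) = j * (x * (b * j)) * x := by noncomm_ring
      _ = 0 := by rw [this]; simp
  have ns : ∀ γ, ∀ a ∈ 𝒜 γ, (∀ j ∈ J, a * j = 0) →
      (∀ k, (∀ j ∈ J, j * k = 0) → a * k = 0) → a = 0 := by
    intro γ a ha h1 h2
    have h3 := lr γ a ha h1
    obtain ⟨b, hb⟩ := hreg a ⟨γ, ha⟩
    rw [← hb, mul_assoc]
    apply h2
    intro j hj
    rw [← mul_assoc]
    exact h3 _ (Jmul j hj b)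
  let I : Set R := {x | ∃ j ∈ J, ∀ i ∈ J, i * (x - j) = 0}
  let f : R → R := fun x => if h : ∃ j ∈ J, ∀ i ∈ J, i * (x - j) = 0 then h.choose else 0
  have fu : ∀ x, ∀ j ∈ J, (∀ i ∈ J, i * (x - j) = 0) → f x = j := by
    intro x j hj hx
    have h : ∃ j ∈ J, ∀ i ∈ J, i * (x - j) = 0 := ⟨j, hj, hx⟩
    have hf : f x = h.choose := dif_pos h
    rw [hf]
    obtain ⟨h1, h2⟩ := h.choose_spec
    rw [← sub_eq_zero]
    apply JN
    · rw [sub_eq_add_neg]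
      exact Jadd _ h1 _ (Jneg _ hj)
    · intro i hi
      have e1 := hx i hi
      have e2 := h2 i hi
      calc i * (h.choose - j) = i * (x - j) - i * (x - h.choose) := by noncomm_ring
        _ = 0 := by rw [e1, e2, sub_zero]
  have hIadd : ∀ x y j k, (∀ i ∈ J, i * (x - j) = 0) → (∀ i ∈ J, i * (y - k) = 0) →
      ∀ i ∈ J, i * (x + y - (j + k)) = 0 := by
    intro x y j k h1 h2 i hi
    rw [add_sub_add_comm, mul_add, h1 i hi, h2 i hi, add_zero]
  have hImul : ∀ x j r, (∀ i ∈ J, i * (x - j) = 0) → ∀ i ∈ J, i * (x * r - j * r) = 0 := by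
    intro x j r h i hi
    rw [← sub_mul, ← mul_assoc, h i hi, zero_mul]
  have hIgr : ∀ x j, (∀ i ∈ J, i * (x - j) = 0) → ∀ γ, ∀ i ∈ J,
      i * (((DirectSum.decompose 𝒜 x γ : 𝒜 γ) : R) - ((DirectSum.decompose 𝒜 j γ : 𝒜 γ) : R)) = 0 := by
    intro x j h γ i hi
    have := Ngr _ h γ i hi
    simpa [DirectSum.decompose_sub] using this
  have hI : IsGradedRightIdeal 𝒜 I := by
    refine ⟨⟨⟨0, J0, by simp⟩, ?_, ?_⟩, ?_⟩
    · rintro x ⟨j, hj, h1⟩ y ⟨k, hk, h2⟩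
      exact ⟨j + k, Jadd j hj k hk, hIadd _ _ _ _ h1 h2⟩
    · rintro x ⟨j, hj, h1⟩ r
      exact ⟨j * r, Jmul j hj r, hImul _ _ _ h1⟩
    · rintro x ⟨j, hj, h1⟩ γ
      exact ⟨_, Jgr j hj γ, hIgr _ _ h1 γ⟩
  obtain ⟨c, hc0, hc⟩ := hinj I hI 0 f
    (by
      rintro x ⟨j, hj, h1⟩ y ⟨k, hk, h2⟩
      rw [fu x j hj h1, fu y k hk h2]
      exact fu _ _ (Jadd j hj k hk) (hIadd _ _ _ _ h1 h2))
    (by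
      rintro x ⟨j, hj, h1⟩ r
      rw [fu x j hj h1]
      exact fu _ _ (Jmul j hj r) (hImul _ _ _ h1))
    (by
      rintro δ x ⟨j, hj, h1⟩ hx
      have h2 := hIgr _ _ h1 δ
      rw [DirectSum.decompose_of_mem_same 𝒜 hx] at h2
      rw [fu x _ (Jgr j hj δ) h2, zero_add]
      exact SetLike.coe_mem _)
  have cJ : ∀ j ∈ J, c * j = j := by
    intro j hj
    have h : ∀ i ∈ J, i * (j - j) = 0 := by simp
    rw [← hc j ⟨j, hj, h⟩, fu j j hj h]
  have cN : ∀ k, (∀ j ∈ J, j * k = 0) → c * k = 0 := by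
    intro k hk
    have h : ∀ i ∈ J, i * (k - 0) = 0 := by simpa using hk
    rw [← hc k ⟨0, J0, h⟩, fu k 0 J0 h]
  have Nl : ∀ r k, (∀ j ∈ J, j * k = 0) → ∀ j ∈ J, j * (r * k) = 0 := by
    intro r k hk j hj
    rw [← mul_assoc]
    exact hk _ (Jmul j hj r)
  have hcc : c * c = c := by
    rw [← sub_eq_zero]
    apply ns 0
    · exact sub_mem (by simpa using SetLike.mul_mem_graded hc0 hc0) hc0
    · intro j hj
      rw [sub_mul, mul_assoc, cJ j hj, cJ j hj, sub_self]
    · intro k hk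
      rw [sub_mul, mul_assoc, cN k hk, mul_zero, sub_self]
  have hcen : ∀ r : R, c * r = r * c := by
    intro r
    have hom : ∀ γ, ∀ s ∈ 𝒜 γ, c * s = s * c := by
      intro γ s hs
      rw [← sub_eq_zero]
      apply ns γ
      · exact sub_mem (by simpa using SetLike.mul_mem_graded hc0 hs)
          (by simpa using SetLike.mul_mem_graded hs hc0)
      · intro j hj
        rw [sub_mul, mul_assoc, mul_assoc, cJ j hj, cJ _ (Jl j hj s), sub_self]
      · intro k hk
        rw [sub_mul, mul_assoc, mul_assoc, cN k hk, cN _ (Nl s k hk), mul_zero, sub_self]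
    rw [← DirectSum.sum_support_decompose 𝒜 r, Finset.sum_mul, Finset.mul_sum]
    exact Finset.sum_congr rfl fun i _ => hom i _ (SetLike.coe_mem _)
  -- uniqueness, one half
  have half : ∀ e ∈ 𝒜 0, ∀ e' ∈ 𝒜 0, e * e = e → e' * e' = e' → (∀ r : R, e' * r = r * e') →
      GradedEssentialIn 𝒜 J {x : R | e * x = x} → J ⊆ {x : R | e' * x = x} → e = e * e' := by
    intro e he e' he' hee hee' hz hess hsub
    by_contra hne
    obtain ⟨x, ⟨hxJ, -, hx2⟩, hx0⟩ := hess.2 {x | e * x = x ∧ e' * x = 0} (by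
      refine ⟨⟨by simp, ?_, ?_⟩, ?_⟩
      · rintro x ⟨h1, h2⟩ y ⟨h3, h4⟩
        exact ⟨by rw [mul_add, h1, h3], by rw [mul_add, h2, h4, add_zero]⟩
      · rintro x ⟨h1, h2⟩ r
        exact ⟨by rw [← mul_assoc, h1], by rw [← mul_assoc, h2, zero_mul]⟩
      · rintro x ⟨h1, h2⟩ γ
        constructor
        · rw [← DirectSum.coe_decompose_mul_of_left_mem_zero 𝒜 he, h1]
        · rw [← DirectSum.coe_decompose_mul_of_left_mem_zero 𝒜 he', h2]
          simp) (fun x hx => hx.1)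
      ⟨e - e * e', ⟨by rw [mul_sub, ← mul_assoc, hee], by
        rw [mul_sub, hz (e * e'), mul_assoc, hee', hz e, sub_self]⟩,
        fun h => hne (sub_eq_zero.mp h)⟩
    have : e' * x = x := hsub hxJ
    exact hx0 (this ▸ hx2)
  have hcess : GradedEssentialIn 𝒜 J {x : R | c * x = x} := by
    refine ⟨cJ, ?_⟩
    rintro K ⟨⟨K0, Kadd, Kmul⟩, Kgr⟩ hK ⟨x, hxK, hx0⟩
    by_contra hno
    push Not at hno
    apply hx0
    apply zt
    intro γ
    have hk := Kgr x hxK γ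
    rw [← (hK hk : c * _ = _)]
    apply cN
    apply lr γ _ (SetLike.coe_mem _)
    intro j hj
    exact hno _ ⟨Jl j hj _, Kmul _ hk j⟩
  refine ⟨c, ⟨hc0, hcc, hcen, hcess⟩, ?_⟩
  rintro e ⟨he0, hee, hez, hess⟩
  have h1 := half e he0 c hc0 hee hcc hcen hess hcess.1
  have h2 := half c hc0 e he0 hcc hee hez hcess hess.1
  exact h1.trans ((hez c).trans h2.symm)
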